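/- Let 𝒯 be an SIP-tree with stratified version 𝒯_str, and let L be the set of monomials in ℝ[Θ_str, z]/⟨θ−z⟩_str obtained from the homogenised root-to-leaf path monomials of 𝒯_str by substituting the label of every first-edge (the first outgoing edge of each vertex) by the variable z. Then L lies in the image of φ_{𝒯_str}, and the preimage of L under φ_{𝒯_str} yields n linearly independent linear forms in ℝ[p₁,…,p_n]. -/

import Mathlib

noncomputable section
open scoped Classical
open MvPolynomial

/-- A staged tree: a finite rooted tree with edges directed away from the root,
each non-root vertex `c` carrying the label `label c` of the edge from `parent c` to `c`;
labels of outgoing edges of a vertex are pairwise distinct, and the outgoing label sets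
of two vertices are either equal (same stage) or disjoint. -/
structure StagedTree (Θ : Type) [DecidableEq Θ] : Type 1 where
  V : Type
  fintypeV : Fintype V
  decEqV : DecidableEq V
  root : V
  parent : V → V
  label : V → Θ
  parent_root : parent root = root
  reaches_root : ∀ v : V, ∃ n : ℕ, parent^[n] v = root
  label_inj : ∀ u v : V, u ≠ root → v ≠ root → parent u = parent v → label u = label v → u = v
  stage_disjoint : ∀ u v : V,
    (∀ θ : Θ, (∃ c, c ≠ root ∧ parent c = u ∧ label c = θ) ↔
        (∃ c, c ≠ root ∧ parent c = v ∧ label c = θ)) ∨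
    (∀ θ : Θ, ¬((∃ c, c ≠ root ∧ parent c = u ∧ label c = θ) ∧
        (∃ c, c ≠ root ∧ parent c = v ∧ label c = θ)))

namespace StagedTree

attribute [instance] StagedTree.fintypeV StagedTree.decEqV

variable {Θ : Type} [DecidableEq Θ] (T : StagedTree Θ)

/-- `c` is a child of `v`. -/
def IsChild (v c : T.V) : Prop := c ≠ T.root ∧ T.parent c = v

/-- `v` is a leaf (no children). -/
def IsLeaf (v : T.V) : Prop := ∀ c, ¬ T.IsChild v c

/-- `w` lies in the subtree rooted at `v` (i.e. `v` is an ancestor of `w` or `w` itself). -/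
def Desc (v w : T.V) : Prop := ∃ n : ℕ, T.parent^[n] w = v

/-- Distance of `v` from the root. -/
def depthOf (v : T.V) : ℕ := Nat.find (T.reaches_root v)

/-- The depth `d` of the tree: maximal number of edges on a root-to-leaf path. -/
def depth : ℕ := Finset.univ.sup T.depthOf

/-- The type of leaves of `T`. -/
def Leaf : Type := {v : T.V // T.IsLeaf v}

instance : Fintype T.Leaf := Subtype.fintype _

/-- Product of the labels along the root-to-`v` path, in `ℝ[Θ]`. -/
def pathProd (v : T.V) : MvPolynomial Θ ℝ :=
  ∏ i ∈ Finset.range (T.depthOf v), X (T.label (T.parent^[i] v))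

/-- Homogenised root-to-`v` path monomial `z^(d - d(λ)) ∏ θ(e)` in `ℝ[Θ, z]`,
where the variable `none` plays the role of `z`. -/
def hpm (v : T.V) : MvPolynomial (Option Θ) ℝ :=
  (X none) ^ (T.depth - T.depthOf v) *
    ∏ i ∈ Finset.range (T.depthOf v), X (some (T.label (T.parent^[i] v)))

/-- The ideal `⟨θ - z⟩` of homogenised local sum-to-one conditions. -/
def sumIdeal : Ideal (MvPolynomial (Option Θ) ℝ) :=
  Ideal.span {f | ∃ v : T.V, ¬ T.IsLeaf v ∧
    f = (∑ c ∈ Finset.univ.filter (fun c => T.IsChild v c), X (some (T.label c))) - X none}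

/-- The homogenised parametrisation `φ_T : ℝ[p] → ℝ[Θ, z]/⟨θ - z⟩`. -/
def phi : MvPolynomial T.Leaf ℝ →ₐ[ℝ] MvPolynomial (Option Θ) ℝ ⧸ T.sumIdeal :=
  aeval (fun l : T.Leaf => Ideal.Quotient.mk T.sumIdeal (T.hpm l.1))

/-- The ideal `⟨θ - 1⟩` of local sum-to-one conditions. -/
def oneIdeal : Ideal (MvPolynomial Θ ℝ) :=
  Ideal.span {f | ∃ v : T.V, ¬ T.IsLeaf v ∧
    f = (∑ c ∈ Finset.univ.filter (fun c => T.IsChild v c), X (T.label c)) - 1}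

/-- The (non-homogenised) parametrisation `φ_T : ℝ[p] → ℝ[Θ]/⟨θ - 1⟩`. -/
def phi1 : MvPolynomial T.Leaf ℝ →ₐ[ℝ] MvPolynomial Θ ℝ ⧸ T.oneIdeal :=
  aeval (fun l : T.Leaf => Ideal.Quotient.mk T.oneIdeal (T.pathProd l.1))

/-- The subtree polynomial `t(v)`: sum over all `v`-to-leaf paths of the products of
edge labels along the path. -/
def tpoly (v : T.V) : MvPolynomial Θ ℝ :=
  ∑ l ∈ Finset.univ.filter (fun w => T.IsLeaf w ∧ T.Desc v w),
    ∏ i ∈ Finset.range (T.depthOf l - T.depthOf v), X (T.label (T.parent^[i] l))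

/-- Two non-leaf vertices are in the same stage when their outgoing label sets coincide. -/
def SameStage (u v : T.V) : Prop :=
  ¬ T.IsLeaf u ∧ ¬ T.IsLeaf v ∧
    ∀ θ : Θ, (∃ c, T.IsChild u c ∧ T.label c = θ) ↔ (∃ c, T.IsChild v c ∧ T.label c = θ)

/-- `T` is balanced: `t(u_i)·t(v_j) = t(u_j)·t(v_i)` for all `u ∼ v` and all pairs of
children matched via the common labels. -/
def Balanced : Prop :=
  ∀ u v ui uj vi vj : T.V, T.SameStage u v →
    T.IsChild u ui → T.IsChild u uj → T.IsChild v vi → T.IsChild v vj →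
    T.label ui = T.label vi → T.label uj = T.label vj →
    T.tpoly ui * T.tpoly vj = T.tpoly uj * T.tpoly vi

/-- `p_{[v]}`: sum of the variables `p_r` over root-to-leaf paths through `v`. -/
def pSum (v : T.V) : MvPolynomial T.Leaf ℝ :=
  ∑ l ∈ Finset.univ.filter (fun l : T.Leaf => T.Desc v l.1), X l

/-- `T` has toric structure: there are linearly independent linear forms in which
`ker φ_T` is generated by binomials. -/
def Toric : Prop :=
  ∃ L : T.Leaf → MvPolynomial T.Leaf ℝ,
    (∀ i, (L i).IsHomogeneous 1) ∧ LinearIndependent ℝ L ∧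
    ∃ B : Set (MvPolynomial T.Leaf ℝ),
      (∀ f ∈ B, ∃ a b : T.Leaf → ℕ, f = (∏ i, L i ^ a i) - (∏ i, L i ^ b i)) ∧
      RingHom.ker T.phi.toRingHom = Ideal.span B

end StagedTree

namespace StagedTree

variable {Θ : Type} [DecidableEq Θ] (T : StagedTree Θ)

open MvPolynomial

/-- The induced subtree of `T` rooted at `v₁` is contained, as an edge-labelled coloured
tree, in the induced subtree rooted at `vi`, via an embedding sending `v₁` to `vi` which
preserves parents, edge labels and stages. -/
def SIPat (v1 vi : T.V) : Prop :=
  ∃ f : T.V → T.V, f v1 = vi ∧ Set.InjOn f {w | T.Desc v1 w} ∧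
    (∀ w, T.Desc v1 w → w ≠ v1 →
      f w ≠ T.root ∧ T.parent (f w) = f (T.parent w) ∧ T.label (f w) = T.label w) ∧
    (∀ w, T.Desc v1 w → ¬ T.IsLeaf w → T.SameStage w (f w))

/-- `T` is an SIP-tree (drawn so that `i_c = 1`, the first label being the least one):
for every vertex of every stage, the subtree rooted at the first child is contained in the
subtree rooted at each child. -/
def IsSIP [LinearOrder Θ] : Prop :=
  ∀ v c1 c : T.V, T.IsChild v c1 → T.IsChild v c →
    (∀ c', T.IsChild v c' → T.label c1 ≤ T.label c') → T.SIPat c1 c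

/-- `x` is reached by a first-edge: the edge into `x` carries the first (least) label of
the stage of its parent. -/
def FirstEdge [LinearOrder Θ] (x : T.V) : Prop :=
  x ≠ T.root ∧ ∀ c, T.IsChild (T.parent x) c → T.label x ≤ T.label c

end StagedTree

namespace StagedTree

variable {Θ : Type} [DecidableEq Θ] (T : StagedTree Θ)

open MvPolynomial

/-- The label, in the stratified tree `𝒯_str`, of the edge into the vertex `x`: the label
in `𝒯` tagged with the distance of the parent of `x` from the root. -/
def labelStr (x : T.V) : Θ × ℕ :=
  (T.label x, T.depthOf (T.parent x))

/-- The homogenised root-to-`v` path monomial of the stratified tree `𝒯_str`. -/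
def mStr (v : T.V) : MvPolynomial (Option (Θ × ℕ)) ℝ :=
  (X none) ^ (T.depth - T.depthOf v) *
    ∏ i ∈ Finset.range (T.depthOf v), X (some (T.labelStr (T.parent^[i] v)))

/-- The ideal `⟨θ − z⟩_str` of homogenised sum-to-one conditions of `𝒯_str`. -/
def strSumIdeal : Ideal (MvPolynomial (Option (Θ × ℕ)) ℝ) :=
  Ideal.span {f | ∃ v : T.V, ¬ T.IsLeaf v ∧
    f = (∑ c ∈ Finset.univ.filter (fun c => T.IsChild v c), X (some (T.labelStr c)))
        - X none}

/-- The homogenised parametrisation `φ_{𝒯_str}` of the stratified tree. -/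
def phiStr : MvPolynomial T.Leaf ℝ →ₐ[ℝ] MvPolynomial (Option (Θ × ℕ)) ℝ ⧸ T.strSumIdeal :=
  aeval (fun l : T.Leaf => Ideal.Quotient.mk T.strSumIdeal (T.mStr l.1))

/-- The variable of `𝒯_str` obtained from the edge into `x` after substituting every
first-edge label by `z`. -/
def subVarStr [LinearOrder Θ] (x : T.V) : Option (Θ × ℕ) :=
  if T.FirstEdge x then none else some (T.labelStr x)

/-- The root-to-leaf path monomial of `𝒯_str` with every first-edge label substituted by
the variable `z`. -/
def zhpmStr [LinearOrder Θ] (v : T.V) : MvPolynomial (Option (Θ × ℕ)) ℝ :=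
  (X none) ^ (T.depth - T.depthOf v) *
    ∏ i ∈ Finset.range (T.depthOf v), X (T.subVarStr (T.parent^[i] v))

section Ancestors

variable {T}

theorem depthOf_root : T.depthOf T.root = 0 := by
  simp [depthOf]

theorem depthOf_eq_zero {v : T.V} : T.depthOf v = 0 ↔ v = T.root := by
  simp [depthOf]

theorem depthOf_of_ne_root {v : T.V} (hv : v ≠ T.root) :
    T.depthOf v = T.depthOf (T.parent v) + 1 := by
  unfold depthOf
  rw [Nat.find_comp_succ (T.reaches_root v) (T.reaches_root (T.parent v)) (by simpa using hv)]
  rfl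

theorem IsChild.depthOf_eq {v c : T.V} (h : T.IsChild v c) :
    T.depthOf c = T.depthOf v + 1 := by
  rw [depthOf_of_ne_root h.1, h.2]

theorem depthOf_iterate_parent (v : T.V) (i : ℕ) :
    T.depthOf (T.parent^[i] v) = T.depthOf v - i := by
  induction i with
  | zero => simp
  | succ i ih =>
    rw [Function.iterate_succ_apply']
    by_cases h : T.parent^[i] v = T.root
    · have h0 := ih
      rw [h, depthOf_root] at h0
      rw [h, T.parent_root, depthOf_root]
      omega
    · have := depthOf_of_ne_root h
      omega

theorem iterate_parent_ne_root {v : T.V} {i : ℕ} (h : i < T.depthOf v) :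
    T.parent^[i] v ≠ T.root := by
  rw [Ne, ← depthOf_eq_zero, depthOf_iterate_parent]
  omega

theorem iterate_parent_depthOf (v : T.V) : T.parent^[T.depthOf v] v = T.root := by
  rw [← depthOf_eq_zero, depthOf_iterate_parent]
  omega

theorem depthOf_le_depth (v : T.V) : T.depthOf v ≤ T.depth :=
  Finset.le_sup (f := T.depthOf) (Finset.mem_univ v)

theorem IsChild.not_isLeaf {v c : T.V} (h : T.IsChild v c) : ¬ T.IsLeaf v :=
  fun hl => hl c h

theorem exists_isChild {v : T.V} (h : ¬ T.IsLeaf v) : ∃ c, T.IsChild v c := by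
  simpa [IsLeaf] using h

theorem IsLeaf.eq_of_iterate_parent {r s : T.V} (hr : T.IsLeaf r)
    (hle : T.depthOf r ≤ T.depthOf s)
    (h : T.parent^[T.depthOf s - T.depthOf r] s = r) : r = s := by
  rcases hle.eq_or_lt with he | hlt
  · simpa [he] using h.symm
  · refine (hr (T.parent^[T.depthOf s - T.depthOf r - 1] s)
      ⟨iterate_parent_ne_root (by omega), ?_⟩).elim
    rw [← Function.iterate_succ_apply' T.parent]
    convert h using 2
    omega

end Ancestors

section Stages

variable {T}

/-- Two vertices sharing an outgoing label have the same outgoing labels. -/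
theorem label_mem_iff_of_common {u v a b : T.V} (ha : T.IsChild u a) (hb : T.IsChild v b)
    (h : T.label a = T.label b) (θ : Θ) :
    (∃ c, T.IsChild u c ∧ T.label c = θ) ↔ (∃ c, T.IsChild v c ∧ T.label c = θ) := by
  rcases T.stage_disjoint u v with hs | hs
  · simpa only [IsChild, and_assoc] using hs θ
  · exact (hs (T.label a) ⟨⟨a, ha.1, ha.2, rfl⟩, ⟨b, hb.1, hb.2, h.symm⟩⟩).elim

theorem FirstEdge.of_label_eq [LinearOrder Θ] {x y : T.V} (hx : T.FirstEdge x)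
    (hy : y ≠ T.root) (h : T.label x = T.label y) : T.FirstEdge y := by
  refine ⟨hy, fun c hc => ?_⟩
  obtain ⟨c', hc', hl⟩ := (label_mem_iff_of_common ⟨hx.1, rfl⟩ ⟨hy, rfl⟩ h (T.label c)).2
    ⟨c, hc, rfl⟩
  rw [← h, ← hl]
  exact hx.2 c' hc'

theorem exists_firstEdge [LinearOrder Θ] {v : T.V} (h : ¬ T.IsLeaf v) :
    ∃ c, T.IsChild v c ∧ T.FirstEdge c := by
  obtain ⟨c₀, hc₀⟩ := exists_isChild h
  obtain ⟨c, hc, hmin⟩ := Finset.exists_min_image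
    (Finset.univ.filter (fun c => T.IsChild v c)) T.label ⟨c₀, by simpa using hc₀⟩
  simp only [Finset.mem_filter, Finset.mem_univ, true_and] at hc hmin
  refine ⟨c, hc, hc.1, fun c' hc' => hmin c' ?_⟩
  rwa [hc.2] at hc'

theorem IsChild.label_injective {v a b : T.V} (ha : T.IsChild v a) (hb : T.IsChild v b)
    (h : T.label a = T.label b) : a = b :=
  T.label_inj a b ha.1 hb.1 (ha.2.trans hb.2.symm) h

theorem FirstEdge.eq_of_isChild [LinearOrder Θ] {v a b : T.V} (ha : T.IsChild v a)
    (hb : T.IsChild v b) (hfa : T.FirstEdge a) (hfb : T.FirstEdge b) : a = b := by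
  refine ha.label_injective hb (le_antisymm (hfa.2 b ?_) (hfb.2 a ?_))
  · rwa [ha.2]
  · rwa [hb.2]

theorem IsChild.labelStr_eq {v c : T.V} (h : T.IsChild v c) :
    T.labelStr c = (T.label c, T.depthOf v) := by
  rw [labelStr, h.2]

/-- Sums over the children of two vertices at the same depth sharing a label agree. -/
theorem sum_children_eq {M : Type*} [AddCommMonoid M] {u v a b : T.V} (ha : T.IsChild u a)
    (hb : T.IsChild v b) (h : T.labelStr a = T.labelStr b) (g : Θ × ℕ → M) :
    ∑ c ∈ Finset.univ.filter (fun c => T.IsChild u c), g (T.labelStr c) =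
      ∑ c ∈ Finset.univ.filter (fun c => T.IsChild v c), g (T.labelStr c) := by
  rw [ha.labelStr_eq, hb.labelStr_eq, Prod.mk.injEq] at h
  have key : ∀ w : T.V, ∑ c ∈ Finset.univ.filter (fun c => T.IsChild w c), g (T.labelStr c) =
      ∑ θ ∈ (Finset.univ.filter (fun c => T.IsChild w c)).image T.label,
        g (θ, T.depthOf w) := by
    intro w
    rw [Finset.sum_image]
    · refine Finset.sum_congr rfl fun c hc => ?_
      rw [IsChild.labelStr_eq (Finset.mem_filter.1 hc).2]
    · intro c hc c' hc' hl
      exact IsChild.label_injective (Finset.mem_filter.1 hc).2 (Finset.mem_filter.1 hc').2 hl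
  rw [key u, key v, h.2]
  refine Finset.sum_congr ?_ fun _ _ => rfl
  ext θ
  simpa using label_mem_iff_of_common ha hb h.1 θ

end Stages

section Image

/-- The images under `phiStr` of the linear forms. -/
def linearImage : Submodule ℝ (MvPolynomial (Option (Θ × ℕ)) ℝ ⧸ T.strSumIdeal) :=
  (homogeneousSubmodule T.Leaf ℝ 1).map T.phiStr.toLinearMap

variable {T}

theorem mk_X_none {v : T.V} (hv : ¬ T.IsLeaf v) :
    Ideal.Quotient.mk T.strSumIdeal (X none) =
      ∑ c ∈ Finset.univ.filter (fun c => T.IsChild v c),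
        Ideal.Quotient.mk T.strSumIdeal (X (some (T.labelStr c))) := by
  rw [← map_sum, eq_comm, Ideal.Quotient.eq]
  exact Ideal.subset_span ⟨v, hv, rfl⟩

theorem IsChild.mStr_eq {v c : T.V} (h : T.IsChild v c) :
    T.mStr c = (X none) ^ (T.depth - (T.depthOf v + 1)) *
      (∏ i ∈ Finset.range (T.depthOf v), X (some (T.labelStr (T.parent^[i] v)))) *
        X (some (T.labelStr c)) := by
  rw [mStr, h.depthOf_eq, Finset.prod_range_succ']
  simp only [Function.iterate_succ_apply, Function.iterate_zero_apply, h.2]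
  ring

theorem mk_mStr_eq_sum {v : T.V} (hv : ¬ T.IsLeaf v) :
    Ideal.Quotient.mk T.strSumIdeal (T.mStr v) =
      ∑ c ∈ Finset.univ.filter (fun c => T.IsChild v c),
        Ideal.Quotient.mk T.strSumIdeal (T.mStr c) := by
  obtain ⟨c₀, hc₀⟩ := exists_isChild hv
  have hd : T.depth - T.depthOf v = T.depth - (T.depthOf v + 1) + 1 := by
    have := depthOf_le_depth c₀
    rw [hc₀.depthOf_eq] at this
    omega
  rw [mStr, hd, pow_succ, mul_right_comm, map_mul, mk_X_none hv, Finset.mul_sum]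
  refine Finset.sum_congr rfl fun c hc => ?_
  simp only [IsChild.mStr_eq (Finset.mem_filter.1 hc).2, map_mul]

theorem mk_mStr_mem_linearImage (v : T.V) :
    Ideal.Quotient.mk T.strSumIdeal (T.mStr v) ∈ T.linearImage := by
  induction hn : T.depth - T.depthOf v using Nat.strong_induction_on generalizing v with
  | _ n ih =>
    by_cases hv : T.IsLeaf v
    · exact ⟨X ⟨v, hv⟩, isHomogeneous_X _ _, aeval_X _ _⟩
    · rw [mk_mStr_eq_sum hv]
      refine Submodule.sum_mem _ fun c hc => ih _ ?_ c rfl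
      have h := IsChild.depthOf_eq (Finset.mem_filter.1 hc).2
      have := depthOf_le_depth c
      omega

variable [LinearOrder Θ]

variable (T) in
/-- The homogenised root-to-`v` path monomial of the stratified tree in which the first-edge
labels among the last `i` edges are substituted by `z`. -/
def partialStr (i : ℕ) (v : T.V) : MvPolynomial (Option (Θ × ℕ)) ℝ :=
  (X none) ^ (T.depth - T.depthOf v) *
    ∏ j ∈ Finset.range (T.depthOf v),
      X (if j < i then T.subVarStr (T.parent^[j] v) else some (T.labelStr (T.parent^[j] v)))

/-- The part of a path monomial away from the edge at position `i`. -/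
theorem partialStr_eq_mul {i k : ℕ} {v : T.V} (h : i < T.depthOf v) :
    T.partialStr k v = (X none) ^ (T.depth - T.depthOf v) *
      (∏ j ∈ (Finset.range (T.depthOf v)).erase i,
        X (if j < k then T.subVarStr (T.parent^[j] v)
          else some (T.labelStr (T.parent^[j] v)))) *
      X (if i < k then T.subVarStr (T.parent^[i] v)
        else some (T.labelStr (T.parent^[i] v))) := by
  rw [partialStr, ← Finset.mul_prod_erase _ _ (Finset.mem_range.2 h)]
  ring

/-- A vertex below a first child has a counterpart below each sibling of that child. -/
theorem exists_transport (hsip : T.IsSIP) {i : ℕ} {v c : T.V} (hi : i < T.depthOf v)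
    (hx : T.FirstEdge (T.parent^[i] v)) (hc : T.IsChild (T.parent^[i + 1] v) c) :
    ∃ w : T.V, T.depthOf w = T.depthOf v ∧ T.parent^[i] w = c ∧
      ∀ j < i, T.subVarStr (T.parent^[j] w) = T.subVarStr (T.parent^[j] v) := by
  set x := T.parent^[i] v with hxdef
  have hcx : T.IsChild (T.parent x) c := by
    rwa [Function.iterate_succ_apply'] at hc
  obtain ⟨f, hfx, -, hedge, -⟩ := hsip (T.parent x) x c ⟨hx.1, rfl⟩ hcx hx.2
  have hdepth : ∀ n w, T.parent^[n] w = x → T.depthOf (f w) = T.depthOf w := by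
    intro n
    induction n with
    | zero =>
      rintro w rfl
      rw [hfx, hcx.depthOf_eq, depthOf_of_ne_root hx.1]
    | succ n ih =>
      intro w hw
      by_cases hwx : w = x
      · rw [hwx, hfx, hcx.depthOf_eq, depthOf_of_ne_root hx.1]
      · have hwr : w ≠ T.root := by
          rintro rfl
          rw [Function.iterate_fixed T.parent_root] at hw
          exact hwx hw
        obtain ⟨h1, h2, -⟩ := hedge w ⟨_, hw⟩ hwx
        rw [depthOf_of_ne_root h1, h2, depthOf_of_ne_root hwr, ih _ hw]
  have hdesc : ∀ j ≤ i, T.parent^[i - j] (T.parent^[j] v) = x := by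
    intro j hj
    rw [← Function.iterate_add_apply, Nat.sub_add_cancel hj]
  have hne : ∀ j < i, T.parent^[j] v ≠ x := by
    intro j hj h
    have h1 := depthOf_iterate_parent v j
    rw [h, hxdef, depthOf_iterate_parent] at h1
    omega
  have hiter : ∀ j ≤ i, T.parent^[j] (f v) = f (T.parent^[j] v) := by
    intro j
    induction j with
    | zero => simp
    | succ j ih =>
      intro hj
      rw [Function.iterate_succ_apply', Function.iterate_succ_apply', ih (by omega)]
      exact (hedge _ ⟨_, hdesc j (by omega)⟩ (hne j hj)).2.1
  refine ⟨f v, hdepth i v rfl, by rw [hiter i le_rfl, ← hxdef, hfx], fun j hj => ?_⟩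
  have hd := hdesc j hj.le
  rw [hiter j hj.le]
  set w := T.parent^[j] v with hw
  have hwr : w ≠ T.root := iterate_parent_ne_root (by omega)
  obtain ⟨h1, h2, h3⟩ := hedge w ⟨_, hd⟩ (hne j hj)
  have hl : T.labelStr (f w) = T.labelStr w := by
    have e1 := hdepth _ w hd
    rw [depthOf_of_ne_root h1, depthOf_of_ne_root hwr] at e1
    rw [labelStr, labelStr, h3, Nat.succ_injective e1]
  have hfe : T.FirstEdge (f w) ↔ T.FirstEdge w :=
    ⟨fun h => h.of_label_eq hwr h3, fun h => h.of_label_eq h1 h3.symm⟩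
  simp only [subVarStr, hl, hfe]

theorem mk_partialStr_mem_linearImage (hsip : T.IsSIP) (i : ℕ) :
    ∀ v : T.V, i ≤ T.depthOf v →
      Ideal.Quotient.mk T.strSumIdeal (T.partialStr i v) ∈ T.linearImage := by
  induction i with
  | zero =>
    intro v _
    simpa [partialStr, mStr] using mk_mStr_mem_linearImage v
  | succ i ih =>
    intro v hv
    have hstep : ∀ j ≠ i, (j < i + 1 ↔ j < i) := fun j hj => by omega
    by_cases hx : T.FirstEdge (T.parent^[i] v)
    · have hu : ¬ T.IsLeaf (T.parent^[i + 1] v) := by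
        refine IsChild.not_isLeaf (c := T.parent^[i] v) ⟨hx.1, ?_⟩
        rw [Function.iterate_succ_apply']
      rw [partialStr_eq_mul (i := i) (by omega), if_pos (by omega), subVarStr, if_pos hx,
        map_mul, mk_X_none hu, Finset.mul_sum]
      refine Submodule.sum_mem _ fun c hc => ?_
      replace hc : T.IsChild (T.parent^[i + 1] v) c := (Finset.mem_filter.1 hc).2
      obtain ⟨w, hw, hwc, hsub⟩ := exists_transport hsip (by omega) hx hc
      have hw_mem := ih w (by omega)
      rw [partialStr_eq_mul (i := i) (by omega), if_neg (by omega), hwc, hw, map_mul] at hw_mem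
      have hfactor : ∀ j ∈ (Finset.range (T.depthOf v)).erase i,
          (X (if j < i + 1 then T.subVarStr (T.parent^[j] v)
            else some (T.labelStr (T.parent^[j] v))) : MvPolynomial (Option (Θ × ℕ)) ℝ) =
          X (if j < i then T.subVarStr (T.parent^[j] w)
            else some (T.labelStr (T.parent^[j] w))) := by
        intro j hj
        have hji := (Finset.mem_erase.1 hj).1
        simp only [hstep j hji]
        split_ifs with hlt
        · rw [hsub j hlt]
        · obtain ⟨k, rfl⟩ : ∃ k, j = k + (i + 1) := ⟨j - (i + 1), by omega⟩
          rw [Function.iterate_add_apply, Function.iterate_add_apply _ _ _ w,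
            Function.iterate_succ_apply' _ _ w, hwc, hc.2]
      rwa [Finset.prod_congr rfl hfactor]
    · have heq : T.partialStr (i + 1) v = T.partialStr i v := by
        unfold partialStr
        congr 1
        refine Finset.prod_congr rfl fun j _ => ?_
        by_cases hji : j = i
        · subst hji
          simp [subVarStr, hx]
        · simp only [hstep j hji]
      rw [heq]
      exact ih v (by omega)

theorem mk_zhpmStr_mem_linearImage (hsip : T.IsSIP) (v : T.V) :
    Ideal.Quotient.mk T.strSumIdeal (T.zhpmStr v) ∈ T.linearImage := by
  have heq : T.zhpmStr v = T.partialStr (T.depthOf v) v := by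
    unfold zhpmStr partialStr
    congr 1
    refine Finset.prod_congr rfl fun j hj => ?_
    rw [if_pos (Finset.mem_range.1 hj)]
  rw [heq]
  exact mk_partialStr_mem_linearImage hsip _ v le_rfl

end Image

section Independence

variable [LinearOrder Θ]

/-- The exponent vector of `zhpmStr`. -/
def zexpStr (v : T.V) : Option (Θ × ℕ) →₀ ℕ :=
  Finsupp.single none (T.depth - T.depthOf v) +
    ∑ i ∈ Finset.range (T.depthOf v), Finsupp.single (T.subVarStr (T.parent^[i] v)) 1

theorem zhpmStr_eq_monomial (v : T.V) : T.zhpmStr v = monomial (T.zexpStr v) 1 := by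
  rw [zhpmStr, zexpStr, monomial_single_add, monomial_sum_one]
  rfl

variable {T}

theorem zexpStr_some_ne_zero {v : T.V} {q : Θ × ℕ} :
    T.zexpStr v (some q) ≠ 0 ↔
      ∃ i < T.depthOf v, T.subVarStr (T.parent^[i] v) = some q := by
  simp [zexpStr, Finsupp.single_apply]

/-- A non-first edge into an ancestor is seen by the exponent vector. -/
theorem labelStr_eq_of_zexpStr_eq {r s : T.V} (h : T.zexpStr r = T.zexpStr s) {k : ℕ}
    (hr : k < T.depthOf r) (hs : k < T.depthOf s)
    (hx : ¬ T.FirstEdge (T.parent^[T.depthOf r - (k + 1)] r)) :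
    T.label (T.parent^[T.depthOf r - (k + 1)] r) =
      T.label (T.parent^[T.depthOf s - (k + 1)] s) := by
  have h1 : T.zexpStr r (some (T.labelStr (T.parent^[T.depthOf r - (k + 1)] r))) ≠ 0 :=
    zexpStr_some_ne_zero.2 ⟨T.depthOf r - (k + 1), by omega, if_neg hx⟩
  rw [h, zexpStr_some_ne_zero] at h1
  obtain ⟨i, hi, he⟩ := h1
  rw [subVarStr] at he
  split_ifs at he
  rw [Option.some_inj, labelStr, labelStr, Prod.mk.injEq, ← Function.iterate_succ_apply' T.parent,
    ← Function.iterate_succ_apply' T.parent, depthOf_iterate_parent, depthOf_iterate_parent] at he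
  obtain ⟨hl, hd⟩ := he
  rw [← hl]
  congr 2
  omega

theorem ancestors_eq_of_zexpStr_eq {r s : T.V} (h : T.zexpStr r = T.zexpStr s) (k : ℕ)
    (hr : k ≤ T.depthOf r) (hs : k ≤ T.depthOf s) :
    T.parent^[T.depthOf r - k] r = T.parent^[T.depthOf s - k] s := by
  induction k with
  | zero => simp [iterate_parent_depthOf]
  | succ k ih =>
    have hu := ih (by omega) (by omega)
    have hchild : ∀ v : T.V, k + 1 ≤ T.depthOf v →
        T.IsChild (T.parent^[T.depthOf v - k] v) (T.parent^[T.depthOf v - (k + 1)] v) := by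
      intro v hv
      refine ⟨iterate_parent_ne_root (by omega), ?_⟩
      rw [← Function.iterate_succ_apply' T.parent]
      congr 1
      omega
    have ha := hchild r hr
    have hb := hchild s hs
    rw [← hu] at hb
    by_cases hx : T.FirstEdge (T.parent^[T.depthOf r - (k + 1)] r)
    · by_cases hy : T.FirstEdge (T.parent^[T.depthOf s - (k + 1)] s)
      · exact FirstEdge.eq_of_isChild ha hb hx hy
      · exact ha.label_injective hb (labelStr_eq_of_zexpStr_eq h.symm hs hr hy).symm
    · exact ha.label_injective hb (labelStr_eq_of_zexpStr_eq h hr hs hx)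

theorem zexpStr_injective : Function.Injective (fun l : T.Leaf => T.zexpStr l.1) := by
  intro r s h
  change T.zexpStr r.1 = T.zexpStr s.1 at h
  apply Subtype.ext
  rcases le_total (T.depthOf r.1) (T.depthOf s.1) with hle | hle
  · refine IsLeaf.eq_of_iterate_parent r.2 hle ?_
    simpa using (ancestors_eq_of_zexpStr_eq h _ le_rfl hle).symm
  · refine (IsLeaf.eq_of_iterate_parent s.2 hle ?_).symm
    simpa using ancestors_eq_of_zexpStr_eq h _ hle le_rfl

variable (T) in
/-- The elimination of the first-edge labels, on the variables. -/
def elimVar : Option (Θ × ℕ) → MvPolynomial (Option (Θ × ℕ)) ℝ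
  | none => X none
  | some q =>
    if h : ∃ x, T.FirstEdge x ∧ T.labelStr x = q then
      X none - ∑ c ∈ (Finset.univ.filter
        (fun c => T.IsChild (T.parent h.choose) c)).erase h.choose, X (some (T.labelStr c))
    else X (some q)

theorem elimVar_of_not_firstEdge {x : T.V} (hx : x ≠ T.root) (h : ¬ T.FirstEdge x) :
    T.elimVar (some (T.labelStr x)) = X (some (T.labelStr x)) := by
  rw [elimVar, dif_neg]
  rintro ⟨y, hy, he⟩
  exact h (hy.of_label_eq hx (congrArg Prod.fst he))

theorem elimVar_of_firstEdge {v x : T.V} (hx : T.IsChild v x) (h : T.FirstEdge x) :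
    T.elimVar (some (T.labelStr x)) = X none -
      ∑ c ∈ (Finset.univ.filter (fun c => T.IsChild v c)).erase x, X (some (T.labelStr c)) := by
  have hex : ∃ y, T.FirstEdge y ∧ T.labelStr y = T.labelStr x := ⟨x, h, rfl⟩
  rw [elimVar, dif_pos hex]
  obtain ⟨hy, he⟩ := hex.choose_spec
  set y := hex.choose
  have hyc : T.IsChild (T.parent y) y := ⟨hy.1, rfl⟩
  have hsum := sum_children_eq hyc hx he
    (fun q => (X (some q) : MvPolynomial (Option (Θ × ℕ)) ℝ))
  rw [← Finset.add_sum_erase _ _ (Finset.mem_filter.2 ⟨Finset.mem_univ _, hyc⟩),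
    ← Finset.add_sum_erase _ _ (Finset.mem_filter.2 ⟨Finset.mem_univ _, hx⟩), he] at hsum
  rw [add_left_cancel hsum]

theorem aeval_elimVar_eq_zero {f : MvPolynomial (Option (Θ × ℕ)) ℝ} (hf : f ∈ T.strSumIdeal) :
    aeval T.elimVar f = 0 := by
  suffices T.strSumIdeal ≤ RingHom.ker (aeval T.elimVar : _ →ₐ[ℝ] _) from this hf
  refine Ideal.span_le.2 ?_
  rintro _ ⟨v, hv, rfl⟩
  obtain ⟨x, hx, hfx⟩ := exists_firstEdge hv
  have hrest : ∀ c ∈ (Finset.univ.filter (fun c => T.IsChild v c)).erase x,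
      T.elimVar (some (T.labelStr c)) = X (some (T.labelStr c)) := by
    intro c hc
    simp only [Finset.mem_erase, Finset.mem_filter, Finset.mem_univ, true_and] at hc
    exact elimVar_of_not_firstEdge hc.2.1
      fun h => hc.1 (FirstEdge.eq_of_isChild hc.2 hx h hfx)
  simp only [SetLike.mem_coe, RingHom.mem_ker, map_sub, map_sum, aeval_X]
  rw [← Finset.add_sum_erase _ _ (Finset.mem_filter.2 ⟨Finset.mem_univ _, hx⟩),
    Finset.sum_congr rfl hrest,
    elimVar_of_firstEdge hx hfx, elimVar]
  ring

variable (T) in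
/-- The elimination of the first-edge labels. -/
def elim : (MvPolynomial (Option (Θ × ℕ)) ℝ ⧸ T.strSumIdeal) →ₐ[ℝ]
    MvPolynomial (Option (Θ × ℕ)) ℝ :=
  Ideal.Quotient.liftₐ T.strSumIdeal (aeval T.elimVar) fun _ hf => aeval_elimVar_eq_zero hf

theorem elim_zhpmStr (v : T.V) :
    T.elim (Ideal.Quotient.mk T.strSumIdeal (T.zhpmStr v)) = T.zhpmStr v := by
  change aeval T.elimVar (T.zhpmStr v) = T.zhpmStr v
  simp only [zhpmStr, map_mul, map_pow, map_prod, aeval_X]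
  refine congrArg₂ _ rfl (Finset.prod_congr rfl fun i hi => ?_)
  rw [subVarStr]
  split_ifs with h
  · rfl
  · exact elimVar_of_not_firstEdge (iterate_parent_ne_root (Finset.mem_range.1 hi)) h

theorem linearIndependent_zhpmStr :
    LinearIndependent ℝ (fun l : T.Leaf => T.zhpmStr l.1) := by
  have heq : (fun l : T.Leaf => T.zhpmStr l.1) =
      basisMonomials (Option (Θ × ℕ)) ℝ ∘ fun l : T.Leaf => T.zexpStr l.1 := by
    funext l
    simp [zhpmStr_eq_monomial]
  rw [heq]
  exact (basisMonomials (Option (Θ × ℕ)) ℝ).linearIndependent.comp _ zexpStr_injective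

end Independence

/-- Let `𝒯` be an SIP-tree with stratified version `𝒯_str` and let `L`
be the set of monomials obtained from the homogenised root-to-leaf path monomials of
`𝒯_str` by substituting the label of every first-edge by `z`. Then `L` lies in the image
of `φ_{𝒯_str}`, and the preimage of `L` yields `n` linearly independent linear forms in
`ℝ[p₁,…,p_n]`. -/
theorem sip_first_edge_monomials_linearly_independent [LinearOrder Θ] (hsip : T.IsSIP) :
    (∀ l : T.Leaf, Ideal.Quotient.mk T.strSumIdeal (T.zhpmStr l.1) ∈ T.phiStr.range) ∧
    (∃ L : T.Leaf → MvPolynomial T.Leaf ℝ,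
      LinearIndependent ℝ L ∧
      ∀ r : T.Leaf, (L r).IsHomogeneous 1 ∧
        T.phiStr (L r) = Ideal.Quotient.mk T.strSumIdeal (T.zhpmStr r.1)) := by
  choose L hL hphi using fun l : T.Leaf => mk_zhpmStr_mem_linearImage hsip l.1
  refine ⟨fun l => ⟨L l, hphi l⟩, L, ?_, fun r => ⟨hL r, hphi r⟩⟩
  refine LinearIndependent.of_comp (T.elim.toLinearMap ∘ₗ T.phiStr.toLinearMap) ?_
  have heq : (T.elim.toLinearMap ∘ₗ T.phiStr.toLinearMap) ∘ L = fun l => T.zhpmStr l.1 :=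
    funext fun l => (congrArg T.elim (hphi l)).trans (elim_zhpmStr l.1)
  rw [heq]
  exact linearIndependent_zhpmStr

end StagedTree
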